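/- For n > 2, the centralizer in L(n) of the Lie subalgebra generated by {B_{1,n}, …, B_{n-1,n}} is exactly the ℤ-span of Δ(n) = Σ_{1 ≤ i < j ≤ n} B_{i,j}. -/

import Mathlib

open FreeLieAlgebra

/-- Index set for the generators `B_{i,j}`, `1 ≤ i < j ≤ n`, of the pure braid Lie algebra. -/
abbrev PBGen (n : ℕ) : Type := {p : Fin n × Fin n // p.1 < p.2}

/-- The generator `B_{i,j}` in the free Lie algebra, with the convention `B_{j,i} = B_{i,j}`
(and `B_{i,i} = 0`, never used). -/
noncomputable def Bpre {n : ℕ} (i j : Fin n) : FreeLieAlgebra ℤ (PBGen n) :=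
  if h : i < j then FreeLieAlgebra.of ℤ ⟨(i, j), h⟩
  else if h' : j < i then FreeLieAlgebra.of ℤ ⟨(j, i), h'⟩ else 0

/-- The infinitesimal braid relations. -/
def pbRelations (n : ℕ) : Set (FreeLieAlgebra ℤ (PBGen n)) :=
  {x | ∃ i j s t : Fin n, ({i, j} ∩ {s, t} : Set (Fin n)) = ∅ ∧
      x = ⁅Bpre i j, Bpre s t⁆} ∪
  {x | ∃ i j s : Fin n, i ≠ j ∧ j ≠ s ∧ i ≠ s ∧
      x = ⁅Bpre i j, Bpre i s + Bpre s j⁆}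

/-- The Lie ideal generated by the infinitesimal braid relations. -/
noncomputable def pbIdeal (n : ℕ) : LieIdeal ℤ (FreeLieAlgebra ℤ (PBGen n)) :=
  LieSubmodule.lieSpan ℤ (FreeLieAlgebra ℤ (PBGen n)) (pbRelations n)

/-- `L(n)`, the holonomy Lie algebra of the pure braid arrangement. -/
abbrev LnAlg (n : ℕ) : Type := FreeLieAlgebra ℤ (PBGen n) ⧸ pbIdeal n

/-- The class of `B_{i,j}` in `L(n)`. -/
noncomputable def Bq {n : ℕ} (i j : Fin n) : LnAlg n :=
  LieSubmodule.Quotient.mk' (pbIdeal n) (Bpre i j)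

/-- `Δ(n) = Σ_{1 ≤ i < j ≤ n} B_{i,j}` in `L(n)`. -/
noncomputable def Delta (n : ℕ) : LnAlg n :=
  ∑ p : PBGen n, LieSubmodule.Quotient.mk' (pbIdeal n) (FreeLieAlgebra.of ℤ p)

namespace LieAlgebra

section SquareZero

variable (R L : Type*) [CommRing R] [LieRing L] [LieAlgebra R L]

/-- The square-zero extension of a Lie algebra by its adjoint module. -/
def AdjointExtension (L : Type*) : Type _ := L × L

namespace AdjointExtension

instance : AddCommGroup (AdjointExtension L) := inferInstanceAs (AddCommGroup (L × L))

instance : Module R (AdjointExtension L) := inferInstanceAs (Module R (L × L))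

instance : LieRing (AdjointExtension L) where
  bracket a b := (⁅a.1, b.1⁆, ⁅a.1, b.2⁆ + ⁅a.2, b.1⁆)
  add_lie a b c := Prod.ext (add_lie a.1 b.1 c.1) <| by
    change ⁅a.1 + b.1, c.2⁆ + ⁅a.2 + b.2, c.1⁆ =
      (⁅a.1, c.2⁆ + ⁅a.2, c.1⁆) + (⁅b.1, c.2⁆ + ⁅b.2, c.1⁆)
    simp only [add_lie]; abel
  lie_add a b c := Prod.ext (lie_add a.1 b.1 c.1) <| by
    change ⁅a.1, b.2 + c.2⁆ + ⁅a.2, b.1 + c.1⁆ =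
      (⁅a.1, b.2⁆ + ⁅a.2, b.1⁆) + (⁅a.1, c.2⁆ + ⁅a.2, c.1⁆)
    simp only [lie_add]; abel
  lie_self a := Prod.ext (lie_self a.1) <| by
    change ⁅a.1, a.2⁆ + ⁅a.2, a.1⁆ = 0
    rw [← lie_skew, neg_add_cancel]
  leibniz_lie a b c := Prod.ext (leibniz_lie a.1 b.1 c.1) <| by
    change ⁅a.1, ⁅b.1, c.2⁆ + ⁅b.2, c.1⁆⁆ + ⁅a.2, ⁅b.1, c.1⁆⁆ =
      (⁅⁅a.1, b.1⁆, c.2⁆ + ⁅⁅a.1, b.2⁆ + ⁅a.2, b.1⁆, c.1⁆) +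
        (⁅b.1, ⁅a.1, c.2⁆ + ⁅a.2, c.1⁆⁆ + ⁅b.2, ⁅a.1, c.1⁆⁆)
    simp only [lie_add, add_lie, lie_lie]; abel

instance : LieAlgebra R (AdjointExtension L) where
  lie_smul t a b := Prod.ext (lie_smul t a.1 b.1) <| by
    change ⁅a.1, t • b.2⁆ + ⁅a.2, t • b.1⁆ = t • (⁅a.1, b.2⁆ + ⁅a.2, b.1⁆)
    simp only [lie_smul, smul_add]

variable {L} in
/-- The element of the square-zero extension with given components. -/
def mk (a b : L) : AdjointExtension L := (a, b)

/-- The projection of the square-zero extension onto the Lie algebra. -/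
def fst : AdjointExtension L →ₗ⁅R⁆ L where
  toFun a := a.1
  map_add' _ _ := rfl
  map_smul' _ _ := rfl
  map_lie' := rfl

end AdjointExtension

end SquareZero

namespace SemiDirectSum

variable {R K L M : Type*} [CommRing R] [LieRing K] [LieAlgebra R K] [LieRing L] [LieAlgebra R L]
  [LieRing M] [LieAlgebra R M] {ψ : L →ₗ⁅R⁆ LieDerivation R K K}

/-- The homomorphism out of a semidirect sum defined by compatible homomorphisms on the
summands. -/
def lift (f : K →ₗ⁅R⁆ M) (g : L →ₗ⁅R⁆ M) (h : ∀ l k, f (ψ l k) = ⁅g l, f k⁆) :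
    K ⋊⁅ψ⁆ L →ₗ⁅R⁆ M where
  toFun x := f x.left + g x.right
  map_add' x y := by simp only [add_eq_mk, map_add]; abel
  map_smul' t x := by simp
  map_lie' {x y} := by
    simp only [lie_eq_mk, map_add, map_sub, LieHom.map_lie, h, lie_add, add_lie]
    rw [← lie_skew (f x.left) (g y.right)]
    abel

theorem lift_apply (f : K →ₗ⁅R⁆ M) (g : L →ₗ⁅R⁆ M) (h : ∀ l k, f (ψ l k) = ⁅g l, f k⁆)
    (x : K ⋊⁅ψ⁆ L) : lift f g h x = f x.left + g x.right := rfl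

end SemiDirectSum

end LieAlgebra

namespace FreeLieAlgebra

section General

variable {R X : Type*} [CommRing R]

theorem induction {p : FreeLieAlgebra R X → Prop} (zero : p 0) (of : ∀ x, p (of R x))
    (add : ∀ u v, p u → p v → p (u + v)) (smul : ∀ (t : R) u, p u → p (t • u))
    (lie : ∀ u v, p u → p v → p ⁅u, v⁆) (u : FreeLieAlgebra R X) : p u := by
  let S : LieSubalgebra R (FreeLieAlgebra R X) :=
    { carrier := {u | p u}
      add_mem' := fun {u v} => add u v
      zero_mem' := zero
      smul_mem' := smul
      lie_mem' := fun {u v} => lie u v }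
  let φ : FreeLieAlgebra R X →ₗ⁅R⁆ S := FreeLieAlgebra.lift R fun x => ⟨FreeLieAlgebra.of R x, of x⟩
  have h : S.incl.comp φ = LieHom.id := by
    ext x
    simp [φ]
  have hu : (φ u : FreeLieAlgebra R X) = u := LieHom.congr_fun h u
  rw [← hu]
  exact (φ u).2

/-- The derivation of a free Lie algebra with prescribed values on the generators. -/
noncomputable def derivation (f : X → FreeLieAlgebra R X) :
    LieDerivation R (FreeLieAlgebra R X) (FreeLieAlgebra R X) :=
  let φ : FreeLieAlgebra R X →ₗ⁅R⁆ LieAlgebra.AdjointExtension (FreeLieAlgebra R X) :=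
    lift R fun x => .mk (of R x) (f x)
  have h (u) : (φ u).1 = u := by
    have : (LieAlgebra.AdjointExtension.fst R _).comp φ = LieHom.id := by
      ext x
      simp only [LieHom.comp_apply, φ, lift_of_apply]
      rfl
    exact LieHom.congr_fun this u
  { toFun := fun u => (φ u).2
    map_add' := fun u v => by rw [map_add]; rfl
    map_smul' := fun t u => by rw [map_smul]; rfl
    leibniz' := fun u v => by
      change (φ ⁅u, v⁆).2 = ⁅u, (φ v).2⁆ - ⁅v, (φ u).2⁆
      rw [LieHom.map_lie]
      change ⁅(φ u).1, (φ v).2⁆ + ⁅(φ u).2, (φ v).1⁆ = _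
      rw [h, h, sub_eq_add_neg, lie_skew] }

@[simp]
theorem derivation_of (f : X → FreeLieAlgebra R X) (x : X) : derivation f (of R x) = f x := by
  change (lift R _ (of R x) : LieAlgebra.AdjointExtension (FreeLieAlgebra R X)).2 = _
  rw [lift_of_apply]
  rfl

theorem derivation_ext {D₁ D₂ : LieDerivation R (FreeLieAlgebra R X) (FreeLieAlgebra R X)}
    (h : ∀ x, D₁ (of R x) = D₂ (of R x)) : D₁ = D₂ := by
  ext u
  induction u using FreeLieAlgebra.induction with
  | zero => simp
  | of x => exact h x
  | add u v hu hv => rw [map_add, map_add, hu, hv]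
  | smul t u hu => rw [map_smul, map_smul, hu]
  | lie u v hu hv => rw [D₁.apply_lie_eq_add, D₂.apply_lie_eq_add, hu, hv]

end General

/-- The elements of a free Lie algebra that are combinations of brackets of at most `m`
generators. -/
inductive LengthLE {R X : Type*} [CommRing R] : ℕ → FreeLieAlgebra R X → Prop
  | zero (m : ℕ) : LengthLE m 0
  | of (m : ℕ) (x : X) : LengthLE (m + 1) (of R x)
  | add {m : ℕ} {u v : FreeLieAlgebra R X} : LengthLE m u → LengthLE m v → LengthLE m (u + v)
  | smul {m : ℕ} (t : R) {u : FreeLieAlgebra R X} : LengthLE m u → LengthLE m (t • u)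
  | lie {k l m : ℕ} {u v : FreeLieAlgebra R X} :
      k + l ≤ m → LengthLE k u → LengthLE l v → LengthLE m ⁅u, v⁆

namespace LengthLE

variable {R X Z : Type*} [CommRing R] {k l m : ℕ} {u v : FreeLieAlgebra R X}

theorem mono (h : LengthLE k u) (hkl : k ≤ l) : LengthLE l u := by
  induction h generalizing l with
  | zero => exact zero l
  | of m x => obtain ⟨l, rfl⟩ : ∃ n, l = n + 1 := ⟨l - 1, by omega⟩; exact of l x
  | add _ _ hu hv => exact add (hu hkl) (hv hkl)
  | smul t _ hu => exact smul t (hu hkl)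
  | lie h hu hv _ _ => exact lie (h.trans hkl) hu hv

theorem neg (h : LengthLE m u) : LengthLE m (-u) := by
  simpa using smul (-1 : R) h

theorem sub (hu : LengthLE m u) (hv : LengthLE m v) : LengthLE m (u - v) := by
  rw [sub_eq_add_neg]; exact add hu hv.neg

theorem eq_zero (h : LengthLE 0 u) : u = 0 := by
  generalize hm : 0 = m at h
  induction h with
  | zero => rfl
  | of => omega
  | add _ _ hu hv => rw [hu hm, hv hm, add_zero]
  | smul t _ hu => rw [hu hm, smul_zero]
  | lie h _ _ hu _ => rw [hu (by omega), zero_lie]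

theorem exists_lengthLE (u : FreeLieAlgebra R X) : ∃ m, LengthLE m u := by
  induction u using FreeLieAlgebra.induction with
  | zero => exact ⟨0, zero 0⟩
  | of x => exact ⟨1, of 0 x⟩
  | add u v hu hv =>
    obtain ⟨k, hu⟩ := hu
    obtain ⟨l, hv⟩ := hv
    exact ⟨k + l, add (hu.mono (by omega)) (hv.mono (by omega))⟩
  | smul t u hu => exact hu.imp fun _ h => smul t h
  | lie u v hu hv =>
    obtain ⟨k, hu⟩ := hu
    obtain ⟨l, hv⟩ := hv
    exact ⟨k + l, lie le_rfl hu hv⟩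

theorem map {f : FreeLieAlgebra R X →ₗ⁅R⁆ FreeLieAlgebra R Z}
    (hf : ∀ x, LengthLE 1 (f (FreeLieAlgebra.of R x))) (h : LengthLE m u) :
    LengthLE m (f u) := by
  induction h with
  | zero m => simpa using zero m
  | of m x => exact (hf x).mono (by omega)
  | add _ _ hu hv => rw [map_add]; exact add hu hv
  | smul t _ hu => rw [map_smul]; exact smul t hu
  | lie h _ _ hu hv => rw [LieHom.map_lie]; exact lie h hu hv

theorem derivation {f : X → FreeLieAlgebra R X} (hf : ∀ x, LengthLE 1 (f x))
    (h : LengthLE m u) : LengthLE m (derivation f u) := by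
  induction h with
  | zero m => simpa using zero m
  | of m x => rw [derivation_of]; exact (hf x).mono (by omega)
  | add _ _ hu hv => rw [map_add]; exact add hu hv
  | smul t _ hu => rw [map_smul]; exact smul t hu
  | lie h hu' hv' hu hv =>
    rw [LieDerivation.apply_lie_eq_add]
    exact add (lie h hu' hv) (lie h hu hv')

end LengthLE

section Elimination

variable {R X : Type*} [CommRing R]

attribute [local instance] LieRing.ofAssociativeRing

/-- The homomorphism from the abelian Lie algebra `R` with prescribed value at `1`. -/
def ofScalar {L : Type*} [LieRing L] [LieAlgebra R L] (u : L) : R →ₗ⁅R⁆ L where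
  toLinearMap := LinearMap.toSpanSingleton R _ u
  map_lie' {a b} := by
    simp [Ring.lie_def, mul_comm a b]

theorem ofScalar_apply {L : Type*} [LieRing L] [LieAlgebra R L] (u : L) (t : R) :
    ofScalar u t = t • u := rfl

/-- The derivation of the free Lie algebra on the symbols `(k, y)`, thought of as
`(ad x)ᵏ y`, that increases `k` by one. -/
noncomputable def shift (R X : Type*) [CommRing R] :
    LieDerivation R (FreeLieAlgebra R (ℕ × X)) (FreeLieAlgebra R (ℕ × X)) :=
  derivation fun p => of R (p.1 + 1, p.2)

open LieAlgebra

open Classical in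
/-- Lazard elimination of the generator `x`: it becomes the second summand of a semidirect sum. -/
noncomputable def eliminate (R : Type*) [CommRing R] (x : X) :
    FreeLieAlgebra R X →ₗ⁅R⁆ FreeLieAlgebra R (ℕ × X) ⋊⁅ofScalar (shift R X)⁆ R :=
  lift R fun y => if y = x then ⟨0, 1⟩ else ⟨of R (0, y), 0⟩

/-- The homomorphism sending the symbol `(k, y)` to `(ad x)ᵏ y`. -/
noncomputable def expand (R : Type*) [CommRing R] (x : X) :
    FreeLieAlgebra R (ℕ × X) →ₗ⁅R⁆ FreeLieAlgebra R X :=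
  lift R fun p => (fun u => ⁅of R x, u⁆)^[p.1] (of R p.2)

theorem expand_shift (x : X) (u : FreeLieAlgebra R (ℕ × X)) :
    expand R x (shift R X u) = ⁅of R x, expand R x u⁆ := by
  induction u using FreeLieAlgebra.induction with
  | zero => simp
  | of p => simp [expand, shift, Function.iterate_succ_apply']
  | add u v hu hv => simp only [map_add, hu, hv, lie_add]
  | smul t u hu => simp only [map_smul, hu, lie_smul]
  | lie u v hu hv =>
    rw [LieDerivation.apply_lie_eq_add, map_add, LieHom.map_lie, LieHom.map_lie, LieHom.map_lie,
      hu, hv, leibniz_lie (of R x), add_comm]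

theorem expand_eliminate (x : X) (u : FreeLieAlgebra R X) :
    expand R x (eliminate R x u).left + (eliminate R x u).right • of R x = u := by
  have h : (SemiDirectSum.lift (expand R x) (ofScalar (of R x)) fun t k => by
      rw [ofScalar_apply, ofScalar_apply, LieDerivation.smul_apply, map_smul, expand_shift,
        smul_lie]).comp (eliminate R x) = LieHom.id := by
    ext y
    rw [LieHom.comp_apply, SemiDirectSum.lift_apply, ofScalar_apply, eliminate, lift_of_apply]
    split_ifs with hy
    · simp [hy]
    · simp [expand]
  exact LieHom.congr_fun h u

open Classical in
/-- The endomorphism of the free Lie algebra on the symbols `(k, y)` that kills all symbols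
with `k ≠ 0` or `y = x`. -/
noncomputable def restrictZero (R : Type*) [CommRing R] (x : X) :
    FreeLieAlgebra R (ℕ × X) →ₗ⁅R⁆ FreeLieAlgebra R (ℕ × X) :=
  lift R fun p => if p.1 = 0 ∧ p.2 ≠ x then of R p else 0

theorem LengthLE.restrictZero (x : X) {m : ℕ} {u : FreeLieAlgebra R (ℕ × X)} (h : LengthLE m u) :
    LengthLE m (FreeLieAlgebra.restrictZero R x u) := by
  refine h.map fun p => ?_
  rw [FreeLieAlgebra.restrictZero, lift_of_apply]
  split_ifs
  exacts [.of 0 p, .zero 1]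

theorem LengthLE.shift {m : ℕ} {u : FreeLieAlgebra R (ℕ × X)} (h : LengthLE m u) :
    LengthLE m (FreeLieAlgebra.shift R X u) :=
  h.derivation fun _ => .of 0 _

theorem lengthLE_eliminate (x : X) {m : ℕ} {u : FreeLieAlgebra R X} (h : LengthLE m u) :
    LengthLE m (eliminate R x u).left ∧
      LengthLE (m - 1) ((eliminate R x u).left - restrictZero R x (eliminate R x u).left) := by
  induction h with
  | zero m =>
    have : (eliminate R x 0).left = 0 := by rw [map_zero]; rfl
    simpa [this] using ⟨LengthLE.zero m, LengthLE.zero _⟩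
  | of m y =>
    rw [eliminate, lift_of_apply]
    split_ifs with hy
    · simpa using ⟨LengthLE.zero (m + 1), LengthLE.zero m⟩
    · refine ⟨.of m _, ?_⟩
      simpa [restrictZero, hy] using LengthLE.zero m
  | @add m u v _ _ hu hv =>
    have : (eliminate R x (u + v)).left = (eliminate R x u).left + (eliminate R x v).left := by
      rw [map_add]; rfl
    rw [this, map_add, add_sub_add_comm]
    exact ⟨hu.1.add hv.1, hu.2.add hv.2⟩
  | @smul m t u _ hu =>
    have : (eliminate R x (t • u)).left = t • (eliminate R x u).left := by
      rw [map_smul]; rfl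
    rw [this, map_smul, ← smul_sub]
    exact ⟨hu.1.smul t, hu.2.smul t⟩
  | @lie k l m u v h hu' hv' hu hv =>
    rcases Nat.eq_zero_or_pos k with rfl | hk
    · have : (eliminate R x 0).left = 0 := by rw [map_zero]; rfl
      rw [hu'.eq_zero, zero_lie, this, map_zero, sub_zero]
      exact ⟨.zero _, .zero _⟩
    rcases Nat.eq_zero_or_pos l with rfl | hl
    · have : (eliminate R x 0).left = 0 := by rw [map_zero]; rfl
      rw [hv'.eq_zero, lie_zero, this, map_zero, sub_zero]
      exact ⟨.zero _, .zero _⟩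
    set a := eliminate R x u with ha
    set b := eliminate R x v with hb
    have hab : (eliminate R x ⁅u, v⁆).left =
        ⁅a.left, b.left⁆ + (a.right • shift R X b.left - b.right • shift R X a.left) := by
      rw [LieHom.map_lie, ← add_sub_assoc]; rfl
    have hD : LengthLE (m - 1) (a.right • shift R X b.left - b.right • shift R X a.left) :=
      ((hv.1.shift.smul _).mono (by omega)).sub ((hu.1.shift.smul _).mono (by omega))
    rw [hab]
    refine ⟨(hu.1.lie h hv.1).add (hD.mono (by omega)), ?_⟩
    rw [map_add, add_sub_add_comm]
    refine .add ?_ (hD.sub (hD.restrictZero x))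
    have : ⁅a.left, b.left⁆ - restrictZero R x ⁅a.left, b.left⁆ =
        ⁅a.left - restrictZero R x a.left, b.left⁆ +
          ⁅restrictZero R x a.left, b.left - restrictZero R x b.left⁆ := by
      rw [LieHom.map_lie, sub_lie, lie_sub]; abel
    rw [this]
    exact (hu.2.lie (by omega) hv.1).add ((hu.1.restrictZero x).lie (by omega) hv.2)

open Classical in
/-- The endomorphism of a free Lie algebra that kills the generators in `S`. -/
noncomputable def kill (R : Type*) [CommRing R] (S : Finset X) :
    FreeLieAlgebra R X →ₗ⁅R⁆ FreeLieAlgebra R X :=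
  lift R fun y => if y ∈ S then 0 else of R y

theorem kill_expand_restrictZero (x : X) (u : FreeLieAlgebra R (ℕ × X)) :
    kill R {x} (expand R x (restrictZero R x u)) = expand R x (restrictZero R x u) := by
  suffices h : (kill R {x}).comp ((expand R x).comp (restrictZero R x)) =
      (expand R x).comp (restrictZero R x) from LieHom.congr_fun h u
  ext p
  rw [LieHom.comp_apply, LieHom.comp_apply, restrictZero, lift_of_apply]
  split_ifs with hp
  · simp [expand, kill, hp.1, hp.2]
  · simp

theorem exists_kill_eq_zero (u : FreeLieAlgebra R X) :
    ∃ S : Finset X, ∀ T, S ⊆ T → kill R T u = 0 := by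
  classical
  induction u using FreeLieAlgebra.induction with
  | zero => exact ⟨∅, fun T _ => map_zero _⟩
  | of x =>
    refine ⟨{x}, fun T hT => ?_⟩
    rw [kill, lift_of_apply, if_pos (hT (Finset.mem_singleton_self x))]
  | add u v hu hv =>
    obtain ⟨S, hS⟩ := hu
    obtain ⟨T, hT⟩ := hv
    refine ⟨S ∪ T, fun U hU => ?_⟩
    rw [map_add, hS U (Finset.union_subset_left hU), hT U (Finset.union_subset_right hU), add_zero]
  | smul t u hu =>
    obtain ⟨S, hS⟩ := hu
    exact ⟨S, fun T hT => by rw [map_smul, hS T hT, smul_zero]⟩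
  | lie u v hu _ =>
    obtain ⟨S, hS⟩ := hu
    exact ⟨S, fun T hT => by rw [LieHom.map_lie, hS T hT, zero_lie]⟩

theorem eq_zero_of_forall_kill_eq {u : FreeLieAlgebra R X} (h : ∀ x, kill R {x} u = u) :
    u = 0 := by
  classical
  obtain ⟨S, hS⟩ := exists_kill_eq_zero u
  rw [← hS S subset_rfl]
  clear hS
  induction S using Finset.induction_on with
  | empty =>
    have : kill R (∅ : Finset X) = LieHom.id := by ext; simp [kill]
    rw [this, LieHom.id_apply]
  | insert x S _ ih =>
    have : kill R (insert x S) = (kill R S).comp (kill R {x}) := by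
      ext y
      by_cases hy : y = x <;> simp [kill, hy]
    rw [this, LieHom.comp_apply, h, ← ih]

theorem LengthLE.eq_zero_of_smul_eq_zero [IsDomain R] {t : R} (ht : t ≠ 0) {m : ℕ} :
    ∀ {X : Type*} {u : FreeLieAlgebra R X}, LengthLE m u → t • u = 0 → u = 0 := by
  induction m with
  | zero => exact fun h _ => h.eq_zero
  | succ m ih =>
    intro X u hu htu
    refine eq_zero_of_forall_kill_eq fun x => ?_
    have h0 : t • eliminate R x u = 0 := by rw [← map_smul, htu, map_zero]
    have hl : t • (eliminate R x u).left = 0 := congrArg SemiDirectSum.left h0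
    have hr : (eliminate R x u).right = 0 :=
      (smul_eq_zero.mp (congrArg SemiDirectSum.right h0 :
        t • (eliminate R x u).right = 0)).resolve_left ht
    have hv := ih (lengthLE_eliminate x hu).2 (by rw [smul_sub, ← map_smul, hl, map_zero, sub_zero])
    have he := expand_eliminate x u
    rw [hr, zero_smul, add_zero] at he
    rw [← he, sub_eq_zero.mp hv, kill_expand_restrictZero]

instance [IsDomain R] : Module.IsTorsionFree R (FreeLieAlgebra R X) :=
  .of_smul_eq_zero fun t u h => by
    obtain ⟨m, hm⟩ := LengthLE.exists_lengthLE u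
    exact or_iff_not_imp_left.mpr fun ht => hm.eq_zero_of_smul_eq_zero ht h

/-- The derivation multiplying each bracket of `m` generators by `m`. -/
noncomputable def euler (R X : Type*) [CommRing R] :
    LieDerivation R (FreeLieAlgebra R X) (FreeLieAlgebra R X) :=
  derivation (of R)

theorem LengthLE.euler_sub {m : ℕ} {u : FreeLieAlgebra R X} (h : LengthLE m u) :
    LengthLE (m - 1) (euler R X u - (m : R) • u) := by
  induction h with
  | zero m => simpa using LengthLE.zero (m - 1)
  | of m x =>
    rcases Nat.eq_zero_or_pos m with rfl | hm
    · simpa [euler] using LengthLE.zero 0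
    · have h1 : LengthLE (m + 1 - 1) (FreeLieAlgebra.of R x) := (LengthLE.of 0 x).mono (by omega)
      rw [euler, derivation_of]
      exact h1.sub (h1.smul _)
  | add _ _ hu hv =>
    rw [map_add, smul_add, add_sub_add_comm]
    exact hu.add hv
  | smul t _ hu =>
    rw [map_smul, smul_comm, ← smul_sub]
    exact hu.smul t
  | @lie k l m u v h hu' hv' hu hv =>
    rcases Nat.eq_zero_or_pos k with rfl | hk
    · simpa [hu'.eq_zero] using LengthLE.zero (m - 1)
    rcases Nat.eq_zero_or_pos l with rfl | hl
    · simpa [hv'.eq_zero] using LengthLE.zero (m - 1)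
    have : euler R X ⁅u, v⁆ - (m : R) • ⁅u, v⁆ =
        ⁅euler R X u - (k : R) • u, v⁆ + ⁅u, euler R X v - (l : R) • v⁆ +
          ((k : R) + l - m) • ⁅u, v⁆ := by
      rw [LieDerivation.apply_lie_eq_add, sub_lie, lie_sub, smul_lie, lie_smul, sub_smul, add_smul]
      abel
    rw [this]
    refine .add ((hu.lie (by omega) hv').add (hu'.lie (by omega) hv)) ?_
    rcases h.eq_or_lt with rfl | h
    · simpa using LengthLE.zero (k + l - 1)
    · exact (hu'.lie (by omega) hv').smul _

theorem eq_zero_of_euler_eq_zero [IsDomain R] [CharZero R] {u : FreeLieAlgebra R X}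
    (h : euler R X u = 0) :
    u = 0 := by
  obtain ⟨m, hm⟩ := LengthLE.exists_lengthLE u
  induction m generalizing u with
  | zero => exact hm.eq_zero
  | succ m ih =>
    have h1 := hm.euler_sub
    rw [h, zero_sub, ← neg_smul, Nat.add_sub_cancel] at h1
    have h2 := ih (by rw [map_smul, h, smul_zero]) h1
    exact (smul_eq_zero.mp h2).resolve_left (neg_ne_zero.mpr (Nat.cast_ne_zero.mpr m.succ_ne_zero))

/-- The derivation of the free Lie algebra on the symbols `(k, y)` that decreases `k` by one and
multiplies by `k`. -/
noncomputable def unshift (R X : Type*) [CommRing R] :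
    LieDerivation R (FreeLieAlgebra R (ℕ × X)) (FreeLieAlgebra R (ℕ × X)) :=
  derivation fun p => (p.1 : R) • of R (p.1 - 1, p.2)

theorem unshift_shift (u : FreeLieAlgebra R (ℕ × X)) :
    unshift R X (shift R X u) = shift R X (unshift R X u) + euler R (ℕ × X) u := by
  suffices h : ⁅unshift R X, shift R X⁆ = euler R (ℕ × X) by
    rw [← h, LieDerivation.lie_apply, add_sub_cancel]
  refine derivation_ext fun ⟨k, y⟩ => ?_
  rcases k with _ | k
  · simp [unshift, shift, euler]
  · simp [unshift, shift, euler, add_smul]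

theorem unshift_euler (u : FreeLieAlgebra R (ℕ × X)) :
    unshift R X (euler R _ u) = euler R _ (unshift R X u) := by
  suffices h : ⁅unshift R X, euler R (ℕ × X)⁆ = 0 by
    rw [← sub_eq_zero, ← LieDerivation.lie_apply, h, LieDerivation.zero_apply]
  refine derivation_ext fun ⟨k, y⟩ => ?_
  simp [unshift, euler]

theorem exists_iterate_unshift_eq_zero (u : FreeLieAlgebra R (ℕ × X)) :
    ∃ m, (unshift R X)^[m] u = 0 := by
  have hs (k : ℕ) (t : R) (u) : (unshift R X)^[k] (t • u) = t • (unshift R X)^[k] u :=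
    (Function.Commute.iterate_left (f := unshift R X) (g := (t • ·))
      (fun u => map_smul (unshift R X) t u) k) u
  induction u using FreeLieAlgebra.induction with
  | zero => exact ⟨0, rfl⟩
  | of p =>
    refine ⟨p.1 + 1, ?_⟩
    obtain ⟨k, y⟩ := p
    induction k with
    | zero => simp [unshift]
    | succ k ih =>
      have h : unshift R X (of R (k + 1, y)) = ((k + 1 : ℕ) : R) • of R (k, y) := by
        simp [unshift]
      rw [Function.iterate_succ_apply, h, hs, ih, smul_zero]
  | add u v hu hv =>
    obtain ⟨k, hk⟩ := hu
    obtain ⟨l, hl⟩ := hv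
    refine ⟨k + l, ?_⟩
    rw [iterate_map_add, add_comm k l, Function.iterate_add_apply, hk, add_comm l k,
      Function.iterate_add_apply, hl, iterate_map_zero, iterate_map_zero, add_zero]
  | smul t u hu =>
    obtain ⟨k, hk⟩ := hu
    exact ⟨k, by rw [hs, hk, smul_zero]⟩
  | lie u v hu hv =>
    obtain ⟨k, hk⟩ := hu
    obtain ⟨l, hl⟩ := hv
    refine ⟨k + l, ?_⟩
    rw [LieDerivation.iterate_apply_lie]
    refine Finset.sum_eq_zero fun p hp => ?_
    rw [Finset.HasAntidiagonal.mem_antidiagonal] at hp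
    rcases le_or_gt k p.1 with h | h
    · rw [← Nat.sub_add_cancel h, Function.iterate_add_apply, hk, iterate_map_zero, zero_lie,
        smul_zero]
    · have h' : l ≤ p.2 := by omega
      rw [← Nat.sub_add_cancel h', Function.iterate_add_apply _ _ l, hl, iterate_map_zero,
        lie_zero, smul_zero]

theorem eq_zero_of_shift_eq_zero [IsDomain R] [CharZero R] {u : FreeLieAlgebra R (ℕ × X)}
    (h : shift R X u = 0) : u = 0 := by
  have hc (m : ℕ) : shift R X ((unshift R X)^[m + 1] u) =
      -((m + 1 : ℕ) : R) • euler R _ ((unshift R X)^[m] u) := by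
    induction m with
    | zero =>
      have := unshift_shift u
      rw [h, map_zero] at this
      simpa using eq_neg_of_add_eq_zero_left this.symm
    | succ m ih =>
      have := unshift_shift ((unshift R X)^[m + 1] u)
      rw [ih, map_smul, unshift_euler, ← Function.iterate_succ_apply' (unshift R X) m,
        ← Function.iterate_succ_apply' (unshift R X) (m + 1), ← sub_eq_iff_eq_add] at this
      rw [← this, Nat.cast_succ (m + 1), neg_add, add_smul, neg_one_smul, sub_eq_add_neg]
  obtain ⟨m, hm⟩ := exists_iterate_unshift_eq_zero u
  induction m with
  | zero => exact hm
  | succ m ih =>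
    have := hc m
    rw [hm, map_zero, eq_comm, smul_eq_zero] at this
    exact ih (eq_zero_of_euler_eq_zero
      (this.resolve_left (neg_ne_zero.mpr (Nat.cast_ne_zero.mpr m.succ_ne_zero))))

theorem eq_smul_of_lie_of_eq_zero [IsDomain R] [CharZero R] {x : X} {u : FreeLieAlgebra R X}
    (h : ⁅of R x, u⁆ = 0) : ∃ t : R, u = t • of R x := by
  have hs : shift R X (eliminate R x u).left = 0 := by
    have h0 : (eliminate R x ⁅of R x, u⁆).left = 0 := by rw [h, map_zero]; rfl
    rw [LieHom.map_lie] at h0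
    simpa [eliminate, ofScalar_apply] using h0
  refine ⟨(eliminate R x u).right, ?_⟩
  conv_lhs => rw [← expand_eliminate x u, eq_zero_of_shift_eq_zero hs, map_zero, zero_add]

end Elimination

end FreeLieAlgebra

namespace FreeLieAlgebra

variable {X M : Type*} [LieRing M]

/-- The universal property of the free Lie algebra over `ℤ`, with respect to the canonical
`ℤ`-algebra structures. -/
noncomputable def intLift (f : X → M) : FreeLieAlgebra ℤ X →ₗ⁅ℤ⁆ M where
  toFun := FreeLieAlgebra.lift ℤ f
  map_add' := map_add _
  map_smul' := map_zsmul (FreeLieAlgebra.lift ℤ f)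
  map_lie' := LieHom.map_lie _ _ _

theorem intLift_of (f : X → M) (x : X) : intLift f (of ℤ x) = f x :=
  FreeLieAlgebra.lift_of_apply f x

theorem int_derivation_ext {D₁ D₂ : LieDerivation ℤ (FreeLieAlgebra ℤ X) (FreeLieAlgebra ℤ X)}
    (h : ∀ x, D₁ (of ℤ x) = D₂ (of ℤ x)) : D₁ = D₂ :=
  derivation_ext h

theorem int_induction {p : FreeLieAlgebra ℤ X → Prop} (zero : p 0) (of : ∀ x, p (of ℤ x))
    (add : ∀ u v, p u → p v → p (u + v)) (smul : ∀ (t : ℤ) u, p u → p (t • u))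
    (lie : ∀ u v, p u → p v → p ⁅u, v⁆) (u : FreeLieAlgebra ℤ X) : p u :=
  FreeLieAlgebra.induction zero of add smul lie u

end FreeLieAlgebra

namespace LnAlg

variable {n : ℕ}

theorem Bpre_comm (i j : Fin n) : Bpre i j = Bpre j i := by
  rcases lt_trichotomy i j with h | rfl | h
  · simp [Bpre, h, h.not_gt]
  · rfl
  · simp [Bpre, h, h.not_gt]

theorem Bpre_self (i : Fin n) : Bpre i i = 0 := by simp [Bpre]

theorem Bq_comm (i j : Fin n) : Bq i j = Bq j i := by rw [Bq, Bq, Bpre_comm]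

theorem Bq_self (i : Fin n) : Bq i i = 0 := by rw [Bq, Bpre_self, map_zero]

theorem lie_Bq_of_disjoint {i j s t : Fin n} (his : i ≠ s) (hit : i ≠ t) (hjs : j ≠ s)
    (hjt : j ≠ t) : ⁅Bq i j, Bq s t⁆ = 0 := by
  refine (LieSubmodule.Quotient.mk_eq_zero (N := pbIdeal n)).mpr
    (LieSubmodule.subset_lieSpan (Or.inl ⟨i, j, s, t, ?_, rfl⟩))
  ext k
  simp only [Set.mem_inter_iff, Set.mem_insert_iff, Set.mem_singleton_iff, Set.mem_empty_iff_false,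
    iff_false]
  rintro ⟨rfl | rfl, rfl | rfl⟩ <;> contradiction

theorem lie_Bq_add {i j s : Fin n} (hij : i ≠ j) (hjs : j ≠ s) (his : i ≠ s) :
    ⁅Bq i j, Bq i s + Bq s j⁆ = 0 :=
  (LieSubmodule.Quotient.mk_eq_zero (N := pbIdeal n)).mpr
    (LieSubmodule.subset_lieSpan (Or.inr ⟨i, j, s, hij, hjs, his, rfl⟩))

theorem lie_Bq_add_lie_Bq {i j s : Fin n} (hij : i ≠ j) (hjs : j ≠ s) (his : i ≠ s) :
    ⁅Bq i j, Bq i s⁆ + ⁅Bq i j, Bq s j⁆ = 0 := by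
  rw [← lie_add, lie_Bq_add hij hjs his]

theorem induction {p : LnAlg n → Prop} (zero : p 0) (gen : ∀ i j, i < j → p (Bq i j))
    (add : ∀ u v, p u → p v → p (u + v)) (smul : ∀ (t : ℤ) u, p u → p (t • u))
    (lie : ∀ u v, p u → p v → p ⁅u, v⁆) (u : LnAlg n) : p u := by
  obtain ⟨u, rfl⟩ := LieSubmodule.Quotient.surjective_mk' (pbIdeal n) u
  induction u using int_induction with
  | zero => rwa [map_zero]
  | of q =>
    have := gen _ _ q.2
    rwa [Bq, Bpre, dif_pos q.2] at this
  | add u v hu hv => rw [map_add]; exact add _ _ hu hv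
  | smul t u hu => rw [map_smul]; exact smul _ _ hu
  | lie u v hu hv => exact lie _ _ hu hv

section Lift

variable {M : Type*} [LieRing M] (b : Fin n → Fin n → M)
  (hcomm : ∀ i j, b i j = b j i) (hself : ∀ i, b i i = 0)
  (hdisj : ∀ i j s t, i ≠ j → s ≠ t → i ≠ s → i ≠ t → j ≠ s → j ≠ t → ⁅b i j, b s t⁆ = 0)
  (hadd : ∀ i j s, i ≠ j → j ≠ s → i ≠ s → ⁅b i j, b i s + b s j⁆ = 0)

include hcomm hself in
theorem lift_Bpre (i j : Fin n) :
    intLift (fun p : PBGen n => b p.1.1 p.1.2) (Bpre i j) = b i j := by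
  rcases lt_trichotomy i j with h | rfl | h
  · simp [Bpre, h, intLift_of]
  · simp [Bpre, hself]
  · simp [Bpre, h, h.not_gt, hcomm i, intLift_of]

include hcomm hself hdisj hadd in
theorem pbIdeal_le_ker :
    pbIdeal n ≤ (intLift fun p : PBGen n => b p.1.1 p.1.2).ker := by
  rw [pbIdeal, LieSubmodule.lieSpan_le]
  rintro _ (⟨i, j, s, t, h, rfl⟩ | ⟨i, j, s, hij, hjs, his, rfl⟩)
  · rw [SetLike.mem_coe, LieHom.mem_ker, LieHom.map_lie, lift_Bpre b hcomm hself,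
      lift_Bpre b hcomm hself]
    rcases eq_or_ne i j with rfl | hij
    · rw [hself, zero_lie]
    rcases eq_or_ne s t with rfl | hst
    · rw [hself, lie_zero]
    have h' (k) (hk : k = i ∨ k = j) : ¬(k = s ∨ k = t) := fun hk' =>
      Set.notMem_empty k (h ▸ ⟨hk, hk'⟩)
    have hi := not_or.mp (h' i (Or.inl rfl))
    have hj := not_or.mp (h' j (Or.inr rfl))
    exact hdisj i j s t hij hst hi.1 hi.2 hj.1 hj.2
  · rw [SetLike.mem_coe, LieHom.mem_ker, LieHom.map_lie, map_add, lift_Bpre b hcomm hself,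
      lift_Bpre b hcomm hself, lift_Bpre b hcomm hself]
    exact hadd i j s hij hjs his

/-- The universal property of `LnAlg n`. -/
noncomputable def lift : LnAlg n →ₗ⁅ℤ⁆ M where
  toLinearMap := (pbIdeal n).toSubmodule.liftQ
    (intLift fun p : PBGen n => b p.1.1 p.1.2 : FreeLieAlgebra ℤ (PBGen n) →ₗ[ℤ] M)
    fun _ hu => LinearMap.mem_ker.mpr
      (LieHom.mem_ker.mp (pbIdeal_le_ker b hcomm hself hdisj hadd hu))
  map_lie' {u v} := by
    obtain ⟨u, rfl⟩ := LieSubmodule.Quotient.surjective_mk' (pbIdeal n) u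
    obtain ⟨v, rfl⟩ := LieSubmodule.Quotient.surjective_mk' (pbIdeal n) v
    exact LieHom.map_lie (intLift fun p : PBGen n => b p.1.1 p.1.2) u v

theorem lift_Bq (i j : Fin n) : LnAlg.lift b hcomm hself hdisj hadd (Bq i j) = b i j :=
  lift_Bpre b hcomm hself i j

end Lift

open FreeLieAlgebra LieAlgebra

theorem lie_add_lie {M : Type*} [LieRing M] (u v : M) : ⁅u, v⁆ + ⁅v, u⁆ = 0 := by
  rw [← lie_skew u v, neg_add_cancel]

/-- The derivation of the free Lie algebra on `Fin n` by which `B_{i,j}` acts. -/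
noncomputable def genDerivation (i j : Fin n) :
    LieDerivation ℤ (FreeLieAlgebra ℤ (Fin n)) (FreeLieAlgebra ℤ (Fin n)) :=
  derivation fun k =>
    (if k = i then ⁅of ℤ i, of ℤ j⁆ else 0) + (if k = j then ⁅of ℤ j, of ℤ i⁆ else 0)

theorem genDerivation_of (i j k : Fin n) :
    genDerivation i j (of ℤ k) =
      (if k = i then ⁅of ℤ i, of ℤ j⁆ else 0) + (if k = j then ⁅of ℤ j, of ℤ i⁆ else 0) :=
  derivation_of _ _

/-- The action of `LnAlg n` on the free Lie algebra on `Fin n`. -/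
noncomputable def action (n : ℕ) :
    LnAlg n →ₗ⁅ℤ⁆ LieDerivation ℤ (FreeLieAlgebra ℤ (Fin n)) (FreeLieAlgebra ℤ (Fin n)) :=
  LnAlg.lift genDerivation
    (fun i j => int_derivation_ext fun k => by rw [genDerivation_of, genDerivation_of, add_comm])
    (fun i => int_derivation_ext fun k => by rw [genDerivation_of]; simp)
    (fun i j s t hij hst his hit hjs hjt => int_derivation_ext fun k => by
      rw [LieDerivation.lie_apply, genDerivation_of, genDerivation_of]
      by_cases h1 : k = i
      · subst h1; simp [*, genDerivation_of]
      by_cases h2 : k = j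
      · subst h2; simp [*, genDerivation_of]
      by_cases h3 : k = s
      · subst h3; simp [*, genDerivation_of, Ne.symm]
      by_cases h4 : k = t
      · subst h4; simp [*, genDerivation_of, Ne.symm]
      simp [*])
    (fun i j s hij hjs his => int_derivation_ext fun k => by
      rw [LieDerivation.lie_apply, LieDerivation.add_apply]
      by_cases h1 : k = i
      · subst h1; simp [*, genDerivation_of, Ne.symm]
      by_cases h2 : k = j
      · subst h2; simp [*, genDerivation_of, Ne.symm]
      by_cases h3 : k = s
      · subst h3
        simp only [genDerivation_of, map_add, hjs.symm, his.symm, ↓reduceIte, add_zero,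
          zero_add, map_zero, sub_zero, LieDerivation.apply_lie_eq_add, zero_lie,
          hij, hij.symm, LieDerivation.coe_zero, Pi.zero_apply]
        rw [← lie_add, ← lie_skew (of ℤ i), neg_add_cancel, lie_zero]
      simp [*, genDerivation_of])

theorem action_Bq_of (i j k : Fin n) :
    action n (Bq i j) (of ℤ k) =
      (if k = i then ⁅of ℤ i, of ℤ j⁆ else 0) + (if k = j then ⁅of ℤ j, of ℤ i⁆ else 0) := by
  rw [action, lift_Bq, genDerivation_of]

/-- The images of the generators of `LnAlg (n + 1)` in the semidirect sum. -/
noncomputable def toSemiDirectSumGen (n : ℕ) (i j : Fin (n + 1)) :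
    FreeLieAlgebra ℤ (Fin n) ⋊⁅action n⁆ LnAlg n :=
  Fin.cases (Fin.cases 0 (fun j => ⟨of ℤ j, 0⟩) j)
    (fun i => Fin.cases ⟨of ℤ i, 0⟩ (fun j => ⟨0, Bq i j⟩) j) i

/-- The decomposition of `LnAlg (n + 1)` as a semidirect sum of the free Lie algebra on the
`B_{0,j}` with `LnAlg n`. -/
noncomputable def toSemiDirectSum (n : ℕ) :
    LnAlg (n + 1) →ₗ⁅ℤ⁆ FreeLieAlgebra ℤ (Fin n) ⋊⁅action n⁆ LnAlg n :=
  LnAlg.lift (toSemiDirectSumGen n)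
    (fun i j => by
      cases i using Fin.cases <;> cases j using Fin.cases <;>
        simp [toSemiDirectSumGen, Bq_comm])
    (fun i => by
      cases i using Fin.cases <;> simp [toSemiDirectSumGen, Bq_self])
    (fun i j s t hij hst his hit hjs hjt => by
      have hit' := hit.symm
      have hjt' := hjt.symm
      have his' := his.symm
      have hjs' := hjs.symm
      cases i using Fin.cases <;> cases j using Fin.cases <;> cases s using Fin.cases <;>
        cases t using Fin.cases <;>
        simp_all [toSemiDirectSumGen, action_Bq_of, lie_Bq_of_disjoint])
    (fun i j s hij hjs his => by
      cases i using Fin.cases <;> cases j using Fin.cases <;> cases s using Fin.cases <;>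
        simp_all [toSemiDirectSumGen, action_Bq_of, lie_Bq_add_lie_Bq, lie_add_lie, Ne.symm])

theorem toSemiDirectSum_Bq_zero_succ (j : Fin n) :
    toSemiDirectSum n (Bq 0 j.succ) = ⟨of ℤ j, 0⟩ :=
  lift_Bq ..

theorem toSemiDirectSum_Bq_succ_succ (i j : Fin n) :
    toSemiDirectSum n (Bq i.succ j.succ) = ⟨0, Bq i j⟩ :=
  lift_Bq ..

/-- The subalgebra generated by the `B_{0,j}`, as a homomorphism from a free Lie algebra. -/
noncomputable def inclLeft (n : ℕ) : FreeLieAlgebra ℤ (Fin n) →ₗ⁅ℤ⁆ LnAlg (n + 1) :=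
  intLift fun j => Bq 0 j.succ

theorem inclLeft_of (j : Fin n) : inclLeft n (of ℤ j) = Bq 0 j.succ :=
  intLift_of _ j

/-- The homomorphism adding a strand. -/
noncomputable def inclRight (n : ℕ) : LnAlg n →ₗ⁅ℤ⁆ LnAlg (n + 1) :=
  LnAlg.lift (fun i j => Bq i.succ j.succ) (fun _ _ => Bq_comm _ _) (fun _ => Bq_self _)
    (fun _ _ _ _ _ _ _ _ _ _ => by apply lie_Bq_of_disjoint <;> simpa)
    (fun _ _ _ _ _ _ => by apply lie_Bq_add <;> simpa)

theorem inclRight_Bq (i j : Fin n) : inclRight n (Bq i j) = Bq i.succ j.succ :=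
  lift_Bq ..

theorem inclLeft_action_Bq_of (i j k : Fin n) (hij : i ≠ j) :
    inclLeft n (action n (Bq i j) (of ℤ k)) = ⁅Bq i.succ j.succ, inclLeft n (of ℤ k)⁆ := by
  have h (i j : Fin n) (hij : i ≠ j) :
      ⁅Bq i.succ j.succ, Bq 0 i.succ⁆ = ⁅Bq 0 i.succ, Bq 0 j.succ⁆ := by
    have := lie_Bq_add_lie_Bq (i := 0) (j := i.succ) (s := j.succ) (Fin.succ_ne_zero _).symm
      (by simpa) (Fin.succ_ne_zero _).symm
    rw [← lie_skew, Bq_comm i.succ, neg_eq_iff_add_eq_zero]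
    exact (add_comm _ _).trans this
  rw [action_Bq_of]
  by_cases hki : k = i
  · subst hki; simp [hij, inclLeft_of, h]
  by_cases hkj : k = j
  · subst hkj; simp [hki, inclLeft_of, h _ _ hij.symm, Bq_comm i.succ]
  · simp [hki, hkj, inclLeft_of]
    rw [lie_Bq_of_disjoint] <;> simp [Fin.succ_ne_zero, Ne.symm, hki, hkj, eq_comm]

theorem inclLeft_action (l : LnAlg n) (k : FreeLieAlgebra ℤ (Fin n)) :
    inclLeft n (action n l k) = ⁅inclRight n l, inclLeft n k⁆ := by
  induction l using LnAlg.induction generalizing k with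
  | zero => simp
  | gen i j hij =>
    rw [inclRight_Bq]
    induction k using int_induction with
    | zero => simp
    | of k => exact inclLeft_action_Bq_of i j k hij.ne
    | add u v hu hv => simp [hu, hv]
    | smul t u hu => simp [hu]
    | lie u v hu hv =>
      rw [LieDerivation.apply_lie_eq_add, map_add, LieHom.map_lie, LieHom.map_lie, LieHom.map_lie, hu,
        hv, leibniz_lie (Bq i.succ j.succ)]
      exact add_comm _ _
  | add u v hu hv => simp [hu, hv]
  | smul t u hu => simp [hu]
  | lie u v hu hv =>
    rw [LieHom.map_lie, LieDerivation.lie_apply, map_sub, hu, hv, hv, hu, LieHom.map_lie,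
      lie_lie]

theorem toSemiDirectSum_injective (n : ℕ) : Function.Injective (toSemiDirectSum n) := by
  refine Function.LeftInverse.injective
    (g := SemiDirectSum.lift (inclLeft n) (inclRight n) inclLeft_action) fun u => ?_
  induction u using LnAlg.induction with
  | zero => rw [map_zero, map_zero]
  | gen i j hij =>
    cases j using Fin.cases with
    | zero => exact absurd hij (Fin.not_lt_zero _)
    | succ j =>
      rw [SemiDirectSum.lift_apply]
      cases i using Fin.cases with
      | zero => rw [toSemiDirectSum_Bq_zero_succ, inclLeft_of, map_zero, add_zero]
      | succ i => rw [toSemiDirectSum_Bq_succ_succ, inclRight_Bq, map_zero, zero_add]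
  | add u v hu hv => rw [map_add, map_add, hu, hv]
  | smul t u hu => rw [map_zsmul, map_zsmul, hu]
  | lie u v hu hv => rw [LieHom.map_lie, LieHom.map_lie, hu, hv]

theorem Delta_eq_sum (n : ℕ) : Delta n = ∑ i : Fin n, ∑ j : Fin n, if i < j then Bq i j else 0 := by
  rw [Delta, ← Fintype.sum_prod_type', ← Finset.sum_filter,
    Finset.sum_subtype (p := fun p : Fin n × Fin n => p.1 < p.2) _ (by simp)]
  refine Finset.sum_congr rfl fun p _ => ?_
  rw [Bq, Bpre, dif_pos p.2]

theorem toSemiDirectSum_Delta (n : ℕ) :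
    toSemiDirectSum n (Delta (n + 1)) = ⟨∑ j, of ℤ j, Delta n⟩ := by
  rw [Delta_eq_sum, Delta_eq_sum]
  simp_rw [Fin.sum_univ_succ, Fin.succ_lt_succ_iff, Fin.succ_pos, Fin.not_lt_zero, if_true,
    if_false, zero_add, map_add, map_sum, apply_ite (toSemiDirectSum n), map_zero,
    toSemiDirectSum_Bq_zero_succ, toSemiDirectSum_Bq_succ_succ]
  simp_rw [← SemiDirectSum.inl_eq_mk (action n), ← SemiDirectSum.inr_eq_mk (action n)]
  simp_rw [← map_zero (SemiDirectSum.inr (action n)), ← apply_ite (SemiDirectSum.inr (action n)),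
    ← map_sum]
  rw [SemiDirectSum.inl_eq_mk, SemiDirectSum.inr_eq_mk, SemiDirectSum.add_eq_mk, add_zero, zero_add]

theorem action_Delta_of (k : Fin n) :
    action n (Delta n) (of ℤ k) = ⁅of ℤ k, ∑ j, of ℤ j⁆ := by
  let φ : LnAlg n →+ FreeLieAlgebra ℤ (Fin n) :=
    AddMonoidHom.mk' (fun l => action n l (of ℤ k)) fun u v => by
      rw [map_add, LieDerivation.add_apply]
  have h (i j : Fin n) : φ (if i < j then Bq i j else 0) =
      (if i = k then if k < j then ⁅of ℤ k, of ℤ j⁆ else 0 else 0) +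
        (if j = k then if i < k then ⁅of ℤ k, of ℤ i⁆ else 0 else 0) := by
    rw [apply_ite φ, map_zero]
    simp only [φ, AddMonoidHom.mk'_apply, action_Bq_of, eq_comm (a := k)]
    by_cases hi : i = k <;> by_cases hj : j = k <;> simp_all
  change φ (Delta n) = _
  rw [Delta_eq_sum, map_sum]
  simp_rw [map_sum, h, Finset.sum_add_distrib]
  rw [Finset.sum_comm]
  simp only [Finset.sum_ite_eq', Finset.mem_univ, if_true]
  rw [← Finset.sum_add_distrib, lie_sum]
  refine Finset.sum_congr rfl fun j _ => ?_
  rcases lt_trichotomy j k with h | rfl | h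
  · simp [h, h.not_gt]
  · simp
  · simp [h, h.not_gt]

theorem action_Bq_sum_of (i j : Fin n) : action n (Bq i j) (∑ j, of ℤ j) = 0 := by
  simp only [map_sum, action_Bq_of, Finset.sum_add_distrib, Finset.sum_ite_eq', Finset.mem_univ,
    if_true, lie_add_lie]

theorem action_sum_of (l : LnAlg n) : action n l (∑ j, of ℤ j) = 0 := by
  induction l using LnAlg.induction with
  | zero => rw [map_zero, LieDerivation.zero_apply]
  | gen i j hij => exact action_Bq_sum_of i j
  | add u v hu hv => rw [map_add, LieDerivation.add_apply, hu, hv, add_zero]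
  | smul t u hu => rw [map_zsmul, LieDerivation.smul_apply, hu, smul_zero]
  | lie u v hu hv =>
    rw [LieHom.map_lie, LieDerivation.lie_apply, hu, hv, map_zero, map_zero, sub_zero]

theorem lie_Delta (u : LnAlg n) : ⁅u, Delta n⁆ = 0 := by
  induction n with
  | zero => rw [Delta_eq_sum, Fin.sum_univ_zero, lie_zero]
  | succ n ih =>
    induction u using LnAlg.induction with
    | zero => rw [zero_lie]
    | gen i j hij =>
      apply toSemiDirectSum_injective
      rw [LieHom.map_lie, toSemiDirectSum_Delta, map_zero]
      cases j using Fin.cases with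
      | zero => exact absurd hij (Fin.not_lt_zero _)
      | succ j =>
        cases i using Fin.cases with
        | zero => rw [toSemiDirectSum_Bq_zero_succ]; simp [action_Delta_of]
        | succ i => rw [toSemiDirectSum_Bq_succ_succ]; simp [action_sum_of, ih, -map_sum]
    | add u v hu hv => rw [add_lie, hu, hv, add_zero]
    | smul t u hu => rw [smul_lie, hu, smul_zero]
    | lie u v hu hv => rw [lie_lie, hu, hv, lie_zero, lie_zero, sub_zero]

theorem eq_zero_of_smul_of_eq_smul_of {X : Type*} {x y : X} (hxy : x ≠ y) {s t : ℤ}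
    (h : s • of ℤ x = t • of ℤ y) : s = 0 := by
  classical
  let : LieRing ℤ := LieRing.ofAssociativeRing
  simpa [map_zsmul, intLift_of, hxy.symm] using congrArg (intLift (Pi.single x (1 : ℤ))) h

theorem eq_zero (u : LnAlg 1) : u = 0 := by
  induction u using LnAlg.induction with
  | zero => rfl
  | gen i j hij => exact absurd hij (by simp [Subsingleton.elim i j])
  | add u v hu hv => rw [hu, hv, add_zero]
  | smul t u hu => rw [hu, smul_zero]
  | lie u v hu hv => rw [hu, zero_lie]

theorem eq_smul_of_last {v : LnAlg (n + 2)} (hv : (toSemiDirectSum (n + 1) v).right = 0)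
    (h : ⁅v, Bq 0 (Fin.last (n + 1))⁆ = 0) :
    ∃ d : ℤ, toSemiDirectSum (n + 1) v = ⟨d • of ℤ (Fin.last n), 0⟩ := by
  have := congrArg (toSemiDirectSum (n + 1)) h
  rw [LieHom.map_lie, ← Fin.succ_last, toSemiDirectSum_Bq_zero_succ, map_zero] at this
  have := congrArg SemiDirectSum.left this
  simp only [SemiDirectSum.lie_eq_mk, hv, map_zero, LieDerivation.zero_apply, add_zero,
    sub_zero] at this
  obtain ⟨d, hd⟩ := eq_smul_of_lie_of_eq_zero (R := ℤ) (x := Fin.last n)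
    (u := (toSemiDirectSum (n + 1) v).left) (by rw [← lie_skew, this]; exact neg_zero)
  exact ⟨d, SemiDirectSum.ext hd hv⟩

theorem eq_zero_of_lie_Bq_last {v : LnAlg (n + 3)} {d : ℤ}
    (hv : toSemiDirectSum (n + 2) v = ⟨d • of ℤ (Fin.last (n + 1)), 0⟩)
    (h : ⁅v, Bq (Fin.succ 0) (Fin.last (n + 2))⁆ = 0) : d = 0 := by
  have := congrArg (toSemiDirectSum (n + 2)) h
  rw [LieHom.map_lie, ← Fin.succ_last, toSemiDirectSum_Bq_succ_succ, map_zero] at this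
  have := congrArg SemiDirectSum.left this
  simp [hv, action_Bq_of] at this
  obtain ⟨t, ht⟩ := eq_smul_of_lie_of_eq_zero (R := ℤ) (x := Fin.last (n + 1))
    (u := d • of ℤ 0) ((lie_zsmul _ _ d).trans this)
  exact eq_zero_of_smul_of_eq_smul_of (Fin.last_pos).ne ht

theorem eq_smul_Delta : ∀ (n : ℕ) (u : LnAlg (n + 1)),
    (∀ p, p ≠ Fin.last n → ⁅u, Bq p (Fin.last n)⁆ = 0) → ∃ c : ℤ, u = c • Delta (n + 1)
  | 0, u, _ => ⟨0, (eq_zero u).trans (zero_smul ℤ _).symm⟩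
  | n + 1, u, hu => by
    obtain ⟨c, hc⟩ := eq_smul_Delta n (toSemiDirectSum (n + 1) u).right fun p hp => by
      have := congrArg (toSemiDirectSum (n + 1)) (hu p.succ (by simpa [← Fin.succ_last] using hp))
      rw [LieHom.map_lie, ← Fin.succ_last, toSemiDirectSum_Bq_succ_succ, map_zero] at this
      exact congrArg SemiDirectSum.right this
    have hcomm (p) (hp : p ≠ Fin.last (n + 1)) :
        ⁅u - c • Delta (n + 2), Bq p (Fin.last (n + 1))⁆ = 0 := by
      rw [sub_lie, hu p hp, smul_lie, ← lie_skew, lie_Delta, neg_zero, smul_zero, sub_zero]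
    obtain ⟨d, hd⟩ := eq_smul_of_last (v := u - c • Delta (n + 2)) (by
      rw [map_sub, map_zsmul, toSemiDirectSum_Delta, SemiDirectSum.sub_eq_mk]
      change _ - c • Delta (n + 1) = (0 : LnAlg (n + 1))
      rw [hc, sub_self]) (hcomm 0 (Fin.last_pos).ne)
    cases n with
    | zero =>
      refine ⟨c + d, ?_⟩
      rw [add_smul, ← sub_eq_iff_eq_add']
      apply toSemiDirectSum_injective
      rw [hd, map_zsmul, toSemiDirectSum_Delta]
      refine SemiDirectSum.ext ?_ ((eq_zero _).trans (eq_zero _).symm)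
      change _ = d • ∑ j : Fin 1, of ℤ j
      rw [Fin.sum_univ_one]
      rfl
    | succ n =>
      obtain rfl := eq_zero_of_lie_Bq_last hd (hcomm _ (by simp [← Fin.succ_last, Fin.ext_iff]))
      refine ⟨c, sub_eq_zero.mp (toSemiDirectSum_injective _ ?_)⟩
      rw [hd, zero_smul, map_zero]
      rfl

end LnAlg

/-- For `n + 1 > 2`, the centralizer in `L(n+1)` of the Lie subalgebra generated by
`{B_{1,n}, …, B_{n-1,n}}` is exactly the ℤ-span of `Δ(n+1)`. -/
theorem centralizer_eq_span_delta (n : ℕ) (hn : 2 ≤ n) :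
    {x : LnAlg (n + 1) | ∀ w ∈ LieSubalgebra.lieSpan ℤ (LnAlg (n + 1))
        {z | ∃ p : Fin (n + 1), p ≠ Fin.last n ∧ z = Bq p (Fin.last n)}, ⁅x, w⁆ = 0} =
      ↑(Submodule.span ℤ {Delta (n + 1)}) := by
  ext u
  rw [SetLike.mem_coe, Submodule.mem_span_singleton]
  constructor
  · intro h
    obtain ⟨c, rfl⟩ := LnAlg.eq_smul_Delta n u fun p hp =>
      h _ (LieSubalgebra.subset_lieSpan ⟨p, hp, rfl⟩)
    exact ⟨c, rfl⟩
  · rintro ⟨c, rfl⟩ w _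
    rw [smul_lie, ← lie_skew, LnAlg.lie_Delta, neg_zero, smul_zero]
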